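/- arXiv:1904.11156 — 2 statements merged into one kernel-verified Lean document; each statement's English description precedes it below -/
import Mathlib

section
/- Let 𝒳 be a compact subset of ℝ^d, let s ≥ 0 be an integer, and let f and the basis functions ψ_{1,P},…,ψ_{P,P} be s-times continuously differentiable functions from 𝒳 to ℝ. Let X₁,…,X_T ∈ 𝒳 be design points with Ψ the T×P matrix with rows ψ_P(X_t) = (ψ_{1,P}(X_t),…,ψ_{P,P}(X_t)), and suppose Ψ'Ψ is invertible with m := λ_min(Ψ'Ψ/T) > 0. Let ε₁,…,εₙ be random vectors in ℝ^T, uncorrelated across i, with mean zero and covariance matrices Σᵢ; set Σ̄ = (1/n)∑ᵢΣᵢ, ε̄ = (1/n)∑ᵢεᵢ, Ȳ = (f(X₁),…,f(X_T))' + ε̄, β̂ = (Ψ'Ψ)⁻¹Ψ'Ȳ, and f̂_P(x) = ψ_P(x)β̂. For β₀ ∈ ℝ^P let f_{P,0}(x) = ψ_P(x)β₀, N_P := |f − f_{P,0}|_s, and ζ_s(P) := max_{|λ|≤s} sup_{x∈𝒳} ‖∂^λ ψ_P(x)‖. Then E |f̂_P − f|_s ≤ ζ_s(P)·( ( min(P·λ_max(Σ̄),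 tr(Σ̄)) / (n·T·m) )^{1/2} + N_P / m^{1/2} ) + N_P. -/
open MeasureTheory Matrix
open scoped BigOperators

/-- Smallest eigenvalue of a symmetric matrix, via the Rayleigh quotient
(Courant–Fischer characterization). -/
noncomputable def eigMin {m : Type*} [Fintype m] (M : Matrix m m ℝ) : ℝ :=
  sInf {r : ℝ | ∃ x : m → ℝ, x ⬝ᵥ x = 1 ∧ r = x ⬝ᵥ M.mulVec x}

/-- Largest eigenvalue of a symmetric matrix, via the Rayleigh quotient. -/
noncomputable def eigMax {m : Type*} [Fintype m] (M : Matrix m m ℝ) : ℝ :=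
  sSup {r : ℝ | ∃ x : m → ℝ, x ⬝ᵥ x = 1 ∧ r = x ⬝ᵥ M.mulVec x}

/-- Partial derivative of `g : ℝ^d → ℝ` in the `k`-th coordinate direction. -/
noncomputable def pderiv1 {d : ℕ} (k : Fin d) (g : (Fin d → ℝ) → ℝ) :
    (Fin d → ℝ) → ℝ :=
  fun x => fderiv ℝ g x (Pi.single k 1)

/-- Multi-index partial derivative `∂^ℓ g`. -/
noncomputable def mpderiv {d : ℕ} (ℓ : Fin d → ℕ) (g : (Fin d → ℝ) → ℝ) :
    (Fin d → ℝ) → ℝ :=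
  (List.finRange d).foldr (fun k h => (pderiv1 k)^[ℓ k] h) g

/-- Sobolev sup-norm `|g|_s = max_{|ℓ| ≤ s} sup_{x ∈ X} |∂^ℓ g(x)|` on the set `X`. -/
noncomputable def sobNorm {d : ℕ} (s : ℕ) (X : Set (Fin d → ℝ))
    (g : (Fin d → ℝ) → ℝ) : ℝ :=
  ⨆ ℓ : {ℓ : Fin d → ℕ // ∑ k, ℓ k ≤ s}, ⨆ x : X, |mpderiv ℓ.1 g x|

/-- `ζ_s(P) = max_{|ℓ| ≤ s} sup_{x ∈ X} ‖∂^ℓ ψ_P(x)‖` (Euclidean norm, entrywise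
derivatives of the basis vector). -/
noncomputable def zetaS {d P : ℕ} (s : ℕ) (X : Set (Fin d → ℝ))
    (ψ : Fin P → (Fin d → ℝ) → ℝ) : ℝ :=
  ⨆ ℓ : {ℓ : Fin d → ℕ // ∑ k, ℓ k ≤ s}, ⨆ x : X,
    Real.sqrt (∑ j, (mpderiv ℓ.1 (ψ j) x) ^ 2)

section MultiIndexDerivatives

variable {d : ℕ}

theorem contDiff_pderiv1 {n : ℕ} {k : Fin d} {g : (Fin d → ℝ) → ℝ}
    (hg : ContDiff ℝ ((n + 1 : ℕ) : ℕ∞) g) : ContDiff ℝ (n : ℕ∞) (pderiv1 k g) := by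
  have h : ContDiff ℝ (n : ℕ∞) (fderiv ℝ g) := hg.fderiv_right (by norm_cast)
  exact h.clm_apply contDiff_const

theorem contDiff_pderiv1_iterate {n : ℕ} {k : Fin d} (a : ℕ) {g : (Fin d → ℝ) → ℝ}
    (hg : ContDiff ℝ ((n + a : ℕ) : ℕ∞) g) : ContDiff ℝ (n : ℕ∞) ((pderiv1 k)^[a] g) := by
  induction a generalizing g with
  | zero => simpa using hg
  | succ a ih =>
    rw [Function.iterate_succ_apply]
    exact ih (contDiff_pderiv1 hg)

theorem contDiff_foldr_pderiv1 {n : ℕ} (ℓ : Fin d → ℕ) (L : List (Fin d))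
    {g : (Fin d → ℝ) → ℝ} (hg : ContDiff ℝ ((n + (L.map ℓ).sum : ℕ) : ℕ∞) g) :
    ContDiff ℝ (n : ℕ∞) (L.foldr (fun k h => (pderiv1 k)^[ℓ k] h) g) := by
  induction L generalizing n with
  | nil => simpa using hg
  | cons k L ih =>
    rw [List.foldr_cons]
    refine contDiff_pderiv1_iterate (ℓ k) (ih ?_)
    simpa [add_assoc] using hg

theorem pderiv1_sum_mul {ι : Type*} [Fintype ι] (k : Fin d) {g : ι → (Fin d → ℝ) → ℝ}
    (hg : ∀ i, ContDiff ℝ ((1 : ℕ) : ℕ∞) (g i)) (c : ι → ℝ) :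
    pderiv1 k (fun x => ∑ i, g i x * c i) = fun x => ∑ i, pderiv1 k (g i) x * c i := by
  funext x
  have hd : ∀ i, DifferentiableAt ℝ (g i) x := fun i =>
    ((hg i).differentiable (by simp)).differentiableAt
  have h : HasFDerivAt (fun x => ∑ i, g i x * c i) (∑ i, c i • fderiv ℝ (g i) x) x :=
    HasFDerivAt.fun_sum fun i _ => (hd i).hasFDerivAt.mul_const (c i)
  simp [pderiv1, h.fderiv, mul_comm]

theorem pderiv1_iterate_sum_mul {ι : Type*} [Fintype ι] (k : Fin d) (a : ℕ)
    {g : ι → (Fin d → ℝ) → ℝ} (hg : ∀ i, ContDiff ℝ (a : ℕ∞) (g i)) (c : ι → ℝ) :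
    (pderiv1 k)^[a] (fun x => ∑ i, g i x * c i) =
      fun x => ∑ i, (pderiv1 k)^[a] (g i) x * c i := by
  induction a generalizing g with
  | zero => rfl
  | succ a ih =>
    simp only [Function.iterate_succ_apply]
    rw [pderiv1_sum_mul k (fun i => (hg i).of_le (by norm_cast; omega)) c]
    exact ih fun i => contDiff_pderiv1 (hg i)

theorem foldr_pderiv1_sum_mul {ι : Type*} [Fintype ι] (ℓ : Fin d → ℕ) (L : List (Fin d))
    {g : ι → (Fin d → ℝ) → ℝ} (hg : ∀ i, ContDiff ℝ ((L.map ℓ).sum : ℕ∞) (g i))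
    (c : ι → ℝ) :
    L.foldr (fun k h => (pderiv1 k)^[ℓ k] h) (fun x => ∑ i, g i x * c i) =
      fun x => ∑ i, L.foldr (fun k h => (pderiv1 k)^[ℓ k] h) (g i) x * c i := by
  induction L with
  | nil => rfl
  | cons k L ih =>
    simp only [List.foldr_cons]
    rw [ih fun i => (hg i).of_le (by norm_cast; simp)]
    refine pderiv1_iterate_sum_mul k (ℓ k) (fun i => contDiff_foldr_pderiv1 ℓ L ?_) c
    simpa using hg i

variable {s : ℕ} {ℓ : Fin d → ℕ}

theorem continuous_mpderiv (hℓ : ∑ k, ℓ k ≤ s) {g : (Fin d → ℝ) → ℝ}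
    (hg : ContDiff ℝ (s : ℕ∞) g) : Continuous (mpderiv ℓ g) := by
  refine (contDiff_foldr_pderiv1 (n := 0) ℓ (List.finRange d) (hg.of_le ?_)).continuous
  rw [← List.ofFn_eq_map, List.sum_ofFn]
  exact_mod_cast (by omega)

theorem mpderiv_sum_mul {ι : Type*} [Fintype ι] (hℓ : ∑ k, ℓ k ≤ s)
    {g : ι → (Fin d → ℝ) → ℝ} (hg : ∀ i, ContDiff ℝ (s : ℕ∞) (g i)) (c : ι → ℝ) :
    mpderiv ℓ (fun x => ∑ i, g i x * c i) = fun x => ∑ i, mpderiv ℓ (g i) x * c i := by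
  refine foldr_pderiv1_sum_mul ℓ (List.finRange d) (fun i => (hg i).of_le ?_) c
  rw [← List.ofFn_eq_map, List.sum_ofFn]
  exact_mod_cast hℓ

theorem mpderiv_sub (hℓ : ∑ k, ℓ k ≤ s) {g h : (Fin d → ℝ) → ℝ}
    (hg : ContDiff ℝ (s : ℕ∞) g) (hh : ContDiff ℝ (s : ℕ∞) h) :
    mpderiv ℓ (fun x => g x - h x) = fun x => mpderiv ℓ g x - mpderiv ℓ h x := by
  have := mpderiv_sum_mul hℓ (g := ![g, h])
    (by intro i; fin_cases i <;> assumption) ![1, -1]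
  simpa [Fin.sum_univ_two, sub_eq_add_neg] using this

instance finite_multiIndex : Finite {ℓ : Fin d → ℕ // ∑ k, ℓ k ≤ s} := by
  refine Set.Finite.to_subtype
    ((Set.Finite.pi' fun _ : Fin d => Set.finite_Iic s).subset fun ℓ hℓ k => ?_)
  exact (Finset.single_le_sum (fun _ _ => Nat.zero_le _) (Finset.mem_univ k)).trans hℓ

theorem le_iSup_iSup_of_continuous {ι : Type*} [Finite ι] {X : Set (Fin d → ℝ)}
    (hX : IsCompact X) {F : ι → (Fin d → ℝ) → ℝ} (hF : ∀ i, Continuous (F i)) (i : ι)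
    {x : Fin d → ℝ} (hx : x ∈ X) : F i x ≤ ⨆ i, ⨆ x : X, F i x := by
  have hb : BddAbove (Set.range fun x : X => F i x) := by
    simpa [Set.image_eq_range] using hX.bddAbove_image (hF i).continuousOn
  exact (le_ciSup hb ⟨x, hx⟩).trans
    (le_ciSup (f := fun i => ⨆ x : X, F i x) (Set.finite_range _).bddAbove i)

variable {X : Set (Fin d → ℝ)}

theorem abs_mpderiv_le_sobNorm (hX : IsCompact X) {g : (Fin d → ℝ) → ℝ}
    (hg : ContDiff ℝ (s : ℕ∞) g) (hℓ : ∑ k, ℓ k ≤ s) {x : Fin d → ℝ} (hx : x ∈ X) :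
    |mpderiv ℓ g x| ≤ sobNorm s X g :=
  le_iSup_iSup_of_continuous (ι := {ℓ : Fin d → ℕ // ∑ k, ℓ k ≤ s}) hX
    (F := fun ℓ x => |mpderiv ℓ.1 g x|) (fun ℓ => (continuous_mpderiv ℓ.2 hg).abs) ⟨ℓ, hℓ⟩ hx

theorem abs_le_sobNorm (hX : IsCompact X) {g : (Fin d → ℝ) → ℝ}
    (hg : ContDiff ℝ (s : ℕ∞) g) {x : Fin d → ℝ} (hx : x ∈ X) : |g x| ≤ sobNorm s X g := by
  have h0 : mpderiv (0 : Fin d → ℕ) g = g := by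
    simp [mpderiv]
  simpa [h0] using abs_mpderiv_le_sobNorm hX hg (ℓ := 0) (by simp) hx

theorem sqrt_mpderiv_le_zetaS {P : ℕ} (hX : IsCompact X) {ψ : Fin P → (Fin d → ℝ) → ℝ}
    (hψ : ∀ j, ContDiff ℝ (s : ℕ∞) (ψ j)) (hℓ : ∑ k, ℓ k ≤ s) {x : Fin d → ℝ} (hx : x ∈ X) :
    Real.sqrt (∑ j, (mpderiv ℓ (ψ j) x) ^ 2) ≤ zetaS s X ψ :=
  le_iSup_iSup_of_continuous (ι := {ℓ : Fin d → ℕ // ∑ k, ℓ k ≤ s}) hX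
    (F := fun ℓ x => Real.sqrt (∑ j, (mpderiv ℓ.1 (ψ j) x) ^ 2))
    (fun ℓ => (continuous_finsetSum _ fun j _ =>
      (continuous_mpderiv ℓ.2 (hψ j)).pow 2).sqrt) ⟨ℓ, hℓ⟩ hx

theorem sobNorm_nonneg (g : (Fin d → ℝ) → ℝ) : 0 ≤ sobNorm s X g :=
  Real.iSup_nonneg fun _ => Real.iSup_nonneg fun _ => abs_nonneg _

theorem zetaS_nonneg {P : ℕ} (ψ : Fin P → (Fin d → ℝ) → ℝ) : 0 ≤ zetaS s X ψ :=
  Real.iSup_nonneg fun _ => Real.iSup_nonneg fun _ => Real.sqrt_nonneg _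

theorem sobNorm_sub_le {P : ℕ} (hX : IsCompact X) {f : (Fin d → ℝ) → ℝ}
    (hf : ContDiff ℝ (s : ℕ∞) f) {ψ : Fin P → (Fin d → ℝ) → ℝ}
    (hψ : ∀ j, ContDiff ℝ (s : ℕ∞) (ψ j)) (β β₀ : Fin P → ℝ) :
    sobNorm s X (fun x => (∑ j, ψ j x * β j) - f x) ≤
      zetaS s X ψ * Real.sqrt (∑ j, (β j - β₀ j) ^ 2) +
        sobNorm s X (fun x => f x - ∑ j, ψ j x * β₀ j) := by
  have hlin : ∀ c : Fin P → ℝ, ContDiff ℝ (s : ℕ∞) (fun x => ∑ j, ψ j x * c j) := fun c =>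
    ContDiff.sum fun j _ => (hψ j).mul contDiff_const
  have hnn := add_nonneg (mul_nonneg (zetaS_nonneg (s := s) (X := X) ψ)
    (Real.sqrt_nonneg (∑ j, (β j - β₀ j) ^ 2)))
    (sobNorm_nonneg (s := s) (X := X) (fun x => f x - ∑ j, ψ j x * β₀ j))
  refine Real.iSup_le (fun ℓ => Real.iSup_le (fun x => ?_) hnn) hnn
  have hsplit : (fun x => (∑ j, ψ j x * β j) - f x) = fun x =>
      (∑ j, ψ j x * (β j - β₀ j)) - (f x - ∑ j, ψ j x * β₀ j) := by
    funext x
    simp only [mul_sub, Finset.sum_sub_distrib]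
    ring
  rw [hsplit, mpderiv_sub ℓ.2 (hlin _) (hf.sub (hlin _)), mpderiv_sum_mul ℓ.2 hψ]
  refine (abs_sub _ _).trans (add_le_add ?_ (abs_mpderiv_le_sobNorm hX (hf.sub (hlin _)) ℓ.2 x.2))
  refine le_trans ?_ (mul_le_mul_of_nonneg_right
    (sqrt_mpderiv_le_zetaS hX hψ ℓ.2 x.2) (Real.sqrt_nonneg _))
  rw [← Real.sqrt_mul (Finset.sum_nonneg fun _ _ => sq_nonneg _)]
  exact Real.abs_le_sqrt (Finset.sum_mul_sq_le_sq_mul_sq _ _ _)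

end MultiIndexDerivatives

section RayleighQuotient

variable {m : Type*} [Fintype m]

theorem zero_le_dotProduct_self (x : m → ℝ) : 0 ≤ x ⬝ᵥ x :=
  Finset.sum_nonneg fun i _ => mul_self_nonneg (x i)

theorem dotProduct_inv_sqrt_smul_self {x : m → ℝ} (hx : 0 < x ⬝ᵥ x) :
    ((Real.sqrt (x ⬝ᵥ x))⁻¹ • x) ⬝ᵥ ((Real.sqrt (x ⬝ᵥ x))⁻¹ • x) = 1 := by
  simp only [smul_dotProduct, dotProduct_smul, smul_eq_mul]
  rw [← mul_assoc, ← mul_inv, Real.mul_self_sqrt hx.le, inv_mul_cancel₀ hx.ne']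

theorem dotProduct_mulVec_inv_sqrt_smul (M : Matrix m m ℝ) {x : m → ℝ} (hx : 0 < x ⬝ᵥ x) :
    ((Real.sqrt (x ⬝ᵥ x))⁻¹ • x) ⬝ᵥ M.mulVec ((Real.sqrt (x ⬝ᵥ x))⁻¹ • x) =
      (x ⬝ᵥ M.mulVec x) / (x ⬝ᵥ x) := by
  simp only [mulVec_smul, smul_dotProduct, dotProduct_smul, smul_eq_mul]
  rw [← mul_assoc, ← mul_inv, Real.mul_self_sqrt hx.le, inv_mul_eq_div]

theorem eigMin_mul_le {M : Matrix m m ℝ} (hM : ∀ x, 0 ≤ x ⬝ᵥ M.mulVec x) (x : m → ℝ) :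
    eigMin M * (x ⬝ᵥ x) ≤ x ⬝ᵥ M.mulVec x := by
  rcases (zero_le_dotProduct_self x).eq_or_lt with h | h
  · simpa [← h] using hM x
  · rw [← le_div_iff₀ h]
    refine csInf_le ⟨0, ?_⟩ ⟨_, dotProduct_inv_sqrt_smul_self h,
      (dotProduct_mulVec_inv_sqrt_smul M h).symm⟩
    rintro _ ⟨y, -, rfl⟩
    exact hM y

theorem abs_le_one_of_dotProduct_self {x : m → ℝ} (hx : x ⬝ᵥ x = 1) (i : m) : |x i| ≤ 1 := by
  rw [← sq_le_one_iff_abs_le_one, ← hx, sq]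
  exact Finset.single_le_sum (f := fun i => x i * x i) (fun _ _ => mul_self_nonneg _)
    (Finset.mem_univ i)

theorem le_eigMax_mul (M : Matrix m m ℝ) (x : m → ℝ) :
    x ⬝ᵥ M.mulVec x ≤ eigMax M * (x ⬝ᵥ x) := by
  rcases (zero_le_dotProduct_self x).eq_or_lt with h | h
  · simp [dotProduct_self_eq_zero.1 h.symm]
  · rw [← div_le_iff₀ h]
    refine le_csSup ⟨∑ i, ∑ j, |M i j|, ?_⟩ ⟨_, dotProduct_inv_sqrt_smul_self h,
      (dotProduct_mulVec_inv_sqrt_smul M h).symm⟩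
    rintro _ ⟨y, hy, rfl⟩
    simp only [dotProduct, mulVec, Finset.mul_sum]
    refine Finset.sum_le_sum fun i _ => Finset.sum_le_sum fun j _ => (le_abs_self _).trans ?_
    rw [abs_mul, abs_mul]
    have hi := abs_le_one_of_dotProduct_self hy i
    have hj := abs_le_one_of_dotProduct_self hy j
    calc |y i| * (|M i j| * |y j|) ≤ 1 * (|M i j| * 1) := by gcongr
      _ = |M i j| := by ring

end RayleighQuotient

section LeastSquares

variable {T P : ℕ} {Ψ : Matrix (Fin T) (Fin P) ℝ}

/-- The least-squares coefficient vector of `v` regressed on the columns of `Ψ`. -/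
noncomputable def lsCoeff (Ψ : Matrix (Fin T) (Fin P) ℝ) (v : Fin T → ℝ) : Fin P → ℝ :=
  (Ψᵀ * Ψ)⁻¹.mulVec (Ψᵀ.mulVec v)

theorem lsCoeff_add (v w : Fin T → ℝ) : lsCoeff Ψ (v + w) = lsCoeff Ψ v + lsCoeff Ψ w := by
  simp only [lsCoeff, mulVec_add]

theorem lsCoeff_mulVec (hΨ : IsUnit (Ψᵀ * Ψ).det) (β : Fin P → ℝ) :
    lsCoeff Ψ (Ψ.mulVec β) = β := by
  rw [lsCoeff, mulVec_mulVec β Ψᵀ Ψ, mulVec_mulVec, Matrix.nonsing_inv_mul _ hΨ, one_mulVec]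

theorem gram_mulVec_lsCoeff (hΨ : IsUnit (Ψᵀ * Ψ).det) (v : Fin T → ℝ) :
    (Ψᵀ * Ψ).mulVec (lsCoeff Ψ v) = Ψᵀ.mulVec v := by
  rw [lsCoeff, mulVec_mulVec, Matrix.mul_nonsing_inv _ hΨ, one_mulVec]

theorem dotProduct_gram_mulVec (b : Fin P → ℝ) :
    b ⬝ᵥ (Ψᵀ * Ψ).mulVec b = Ψ.mulVec b ⬝ᵥ Ψ.mulVec b := by
  rw [← mulVec_mulVec, dotProduct_mulVec, vecMul_transpose]

theorem fitted_dotProduct_self (hΨ : IsUnit (Ψᵀ * Ψ).det) (v : Fin T → ℝ) :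
    Ψ.mulVec (lsCoeff Ψ v) ⬝ᵥ Ψ.mulVec (lsCoeff Ψ v) = Ψ.mulVec (lsCoeff Ψ v) ⬝ᵥ v := by
  rw [← dotProduct_gram_mulVec, gram_mulVec_lsCoeff hΨ, dotProduct_mulVec, vecMul_transpose]

theorem fitted_dotProduct_self_le (hΨ : IsUnit (Ψᵀ * Ψ).det) (v : Fin T → ℝ) :
    Ψ.mulVec (lsCoeff Ψ v) ⬝ᵥ Ψ.mulVec (lsCoeff Ψ v) ≤ v ⬝ᵥ v := by
  have h := zero_le_dotProduct_self (v - Ψ.mulVec (lsCoeff Ψ v))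
  rw [sub_dotProduct, dotProduct_sub, dotProduct_sub, dotProduct_comm v (Ψ.mulVec _),
    ← fitted_dotProduct_self hΨ] at h
  linarith

theorem eigMin_mul_dotProduct_self_le (hT : 0 < T) (b : Fin P → ℝ) :
    (T * eigMin ((T : ℝ)⁻¹ • (Ψᵀ * Ψ))) * (b ⬝ᵥ b) ≤ Ψ.mulVec b ⬝ᵥ Ψ.mulVec b := by
  have hT' : (0 : ℝ) < T := by exact_mod_cast hT
  have hquad : ∀ x, x ⬝ᵥ ((T : ℝ)⁻¹ • (Ψᵀ * Ψ)).mulVec x =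
      (T : ℝ)⁻¹ * (Ψ.mulVec x ⬝ᵥ Ψ.mulVec x) := fun x => by
    rw [smul_mulVec, dotProduct_smul, dotProduct_gram_mulVec, smul_eq_mul]
  have h := eigMin_mul_le (M := (T : ℝ)⁻¹ • (Ψᵀ * Ψ)) (fun x => by
    rw [hquad]
    exact mul_nonneg (by positivity) (zero_le_dotProduct_self _)) b
  rw [hquad, inv_mul_eq_div, le_div_iff₀ hT'] at h
  linarith

/-- The orthogonal projection matrix onto the column space of `Ψ`. -/
noncomputable def hatMatrix (Ψ : Matrix (Fin T) (Fin P) ℝ) : Matrix (Fin T) (Fin T) ℝ :=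
  Ψ * (Ψᵀ * Ψ)⁻¹ * Ψᵀ

theorem hatMatrix_mulVec (v : Fin T → ℝ) :
    (hatMatrix Ψ).mulVec v = Ψ.mulVec (lsCoeff Ψ v) := by
  simp only [hatMatrix, lsCoeff, mulVec_mulVec, Matrix.mul_assoc]

theorem sum_hatMatrix_row_dotProduct_self (hΨ : IsUnit (Ψᵀ * Ψ).det) :
    ∑ t, (hatMatrix Ψ).row t ⬝ᵥ (hatMatrix Ψ).row t = P := by
  have hsymm : (hatMatrix Ψ)ᵀ = hatMatrix Ψ := by
    simp [hatMatrix, transpose_mul, transpose_nonsing_inv, Matrix.mul_assoc]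
  have hidem : hatMatrix Ψ * hatMatrix Ψ = hatMatrix Ψ := by
    calc hatMatrix Ψ * hatMatrix Ψ
        = Ψ * (((Ψᵀ * Ψ)⁻¹ * (Ψᵀ * Ψ)) * ((Ψᵀ * Ψ)⁻¹ * Ψᵀ)) := by
          simp only [hatMatrix, Matrix.mul_assoc]
      _ = hatMatrix Ψ := by
          rw [Matrix.nonsing_inv_mul _ hΨ, Matrix.one_mul, hatMatrix, Matrix.mul_assoc]
  calc ∑ t, (hatMatrix Ψ).row t ⬝ᵥ (hatMatrix Ψ).row t
      = (hatMatrix Ψ * (hatMatrix Ψ)ᵀ).trace := rfl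
    _ = (Ψ * ((Ψᵀ * Ψ)⁻¹ * Ψᵀ)).trace := by rw [hsymm, hidem, hatMatrix, Matrix.mul_assoc]
    _ = P := by
      rw [trace_mul_comm, Matrix.mul_assoc, Matrix.nonsing_inv_mul _ hΨ, trace_one,
        Fintype.card_fin]

theorem sqrt_lsCoeff_le (hT : 0 < T) (hΨ : IsUnit (Ψᵀ * Ψ).det)
    (hm : 0 < eigMin ((T : ℝ)⁻¹ • (Ψᵀ * Ψ))) {v : Fin T → ℝ} {N : ℝ} (hN : 0 ≤ N)
    (hv : ∀ t, |v t| ≤ N) :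
    Real.sqrt (lsCoeff Ψ v ⬝ᵥ lsCoeff Ψ v) ≤
      N / Real.sqrt (eigMin ((T : ℝ)⁻¹ • (Ψᵀ * Ψ))) := by
  have hT' : (0 : ℝ) < T := by exact_mod_cast hT
  have hvv : v ⬝ᵥ v ≤ T * N ^ 2 := by
    calc v ⬝ᵥ v ≤ ∑ _t : Fin T, N ^ 2 := Finset.sum_le_sum fun t _ => by
          rw [← sq, ← sq_abs]
          exact pow_le_pow_left₀ (abs_nonneg _) (hv t) 2
      _ = T * N ^ 2 := by simp
  have h := (eigMin_mul_dotProduct_self_le hT (lsCoeff Ψ v)).trans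
    ((fitted_dotProduct_self_le hΨ v).trans hvv)
  rw [mul_assoc] at h
  have h' := le_of_mul_le_mul_left h hT'
  rw [Real.sqrt_le_left (by positivity), div_pow, Real.sq_sqrt hm.le, le_div_iff₀ hm]
  linarith

end LeastSquares

section SecondMoments

variable {Ω : Type*} [MeasurableSpace Ω] {μ : Measure Ω} {T : ℕ} {Z : Ω → Fin T → ℝ}
  {S : Matrix (Fin T) (Fin T) ℝ}

theorem dotProduct_sq_eq_sum (a z : Fin T → ℝ) :
    (a ⬝ᵥ z) ^ 2 = ∑ t, ∑ t', a t * a t' * (z t * z t') := by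
  rw [sq, dotProduct, Finset.sum_mul_sum]
  exact Finset.sum_congr rfl fun _ _ => Finset.sum_congr rfl fun _ _ => by ring

theorem integrable_dotProduct_sq (hZ : ∀ t t', Integrable (fun ω => Z ω t * Z ω t') μ)
    (a : Fin T → ℝ) : Integrable (fun ω => (a ⬝ᵥ Z ω) ^ 2) μ := by
  simp only [dotProduct_sq_eq_sum]
  exact integrable_finsetSum _ fun t _ => integrable_finsetSum _ fun t' _ =>
    (hZ t t').const_mul _

theorem integral_dotProduct_sq (hZ : ∀ t t', Integrable (fun ω => Z ω t * Z ω t') μ)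
    (hS : ∀ t t', ∫ ω, Z ω t * Z ω t' ∂μ = S t t') (a : Fin T → ℝ) :
    ∫ ω, (a ⬝ᵥ Z ω) ^ 2 ∂μ = a ⬝ᵥ S.mulVec a := by
  simp only [dotProduct_sq_eq_sum]
  rw [integral_finsetSum _ fun t _ => integrable_finsetSum _ fun t' _ => (hZ t t').const_mul _]
  simp only [dotProduct, mulVec, Finset.mul_sum]
  refine Finset.sum_congr rfl fun t _ => ?_
  rw [integral_finsetSum _ fun t' _ => (hZ t t').const_mul _]
  refine Finset.sum_congr rfl fun t' _ => ?_
  rw [integral_const_mul, hS]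
  ring

theorem mulVec_dotProduct_self_eq_sum {p : Type*} [Fintype p] (A : Matrix p (Fin T) ℝ)
    (z : Fin T → ℝ) : A.mulVec z ⬝ᵥ A.mulVec z = ∑ i, (A.row i ⬝ᵥ z) ^ 2 :=
  Finset.sum_congr rfl fun _ _ => (sq _).symm

theorem integrable_mulVec_dotProduct_self {p : Type*} [Fintype p]
    (hZ : ∀ t t', Integrable (fun ω => Z ω t * Z ω t') μ) (A : Matrix p (Fin T) ℝ) :
    Integrable (fun ω => A.mulVec (Z ω) ⬝ᵥ A.mulVec (Z ω)) μ := by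
  simp only [mulVec_dotProduct_self_eq_sum]
  exact integrable_finsetSum _ fun i _ => integrable_dotProduct_sq hZ (A.row i)

theorem integral_fitted_le {P : ℕ} {Ψ : Matrix (Fin T) (Fin P) ℝ} (hΨ : IsUnit (Ψᵀ * Ψ).det)
    {c : ℝ} (hc : 0 ≤ c) (hZ : ∀ t t', Integrable (fun ω => Z ω t * Z ω t') μ)
    (hS : ∀ t t', ∫ ω, Z ω t * Z ω t' ∂μ = (c • S) t t') :
    ∫ ω, Ψ.mulVec (lsCoeff Ψ (Z ω)) ⬝ᵥ Ψ.mulVec (lsCoeff Ψ (Z ω)) ∂μ ≤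
      c * min (P * eigMax S) S.trace := by
  have hint : Integrable
      (fun ω => Ψ.mulVec (lsCoeff Ψ (Z ω)) ⬝ᵥ Ψ.mulVec (lsCoeff Ψ (Z ω))) μ := by
    simpa only [hatMatrix_mulVec] using integrable_mulVec_dotProduct_self hZ (hatMatrix Ψ)
  rw [mul_min_of_nonneg _ _ hc]
  refine le_min ?_ ?_
  · simp only [← hatMatrix_mulVec, mulVec_dotProduct_self_eq_sum]
    rw [integral_finsetSum _ fun i _ => integrable_dotProduct_sq hZ ((hatMatrix Ψ).row i)]
    simp only [integral_dotProduct_sq hZ hS, smul_mulVec, dotProduct_smul, smul_eq_mul]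
    rw [← sum_hatMatrix_row_dotProduct_self hΨ, mul_comm _ (eigMax S),
      Finset.mul_sum, Finset.mul_sum]
    exact Finset.sum_le_sum fun t _ => mul_le_mul_of_nonneg_left (le_eigMax_mul S _) hc
  · have hZZ : Integrable (fun ω => Z ω ⬝ᵥ Z ω) μ := integrable_finsetSum _ fun t _ => hZ t t
    refine (integral_mono hint hZZ fun ω => fitted_dotProduct_self_le hΨ (Z ω)).trans_eq ?_
    simp only [dotProduct]
    rw [integral_finsetSum _ fun t _ => hZ t t, trace, Finset.mul_sum]
    exact Finset.sum_congr rfl fun t _ => hS t t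

theorem integrable_sqrt [IsFiniteMeasure μ] {g : Ω → ℝ} (hg : Integrable g μ)
    (h0 : ∀ ω, 0 ≤ g ω) : Integrable (fun ω => Real.sqrt (g ω)) μ := by
  refine ((integrable_const (1 : ℝ)).add hg).mono'
    (Real.continuous_sqrt.comp_aestronglyMeasurable hg.1) (ae_of_all _ fun ω => ?_)
  rw [Real.norm_of_nonneg (Real.sqrt_nonneg _), Pi.add_apply,
    Real.sqrt_le_left (by linarith [h0 ω])]
  nlinarith [h0 ω]

theorem integral_sqrt_le [IsProbabilityMeasure μ] {g : Ω → ℝ} (hg : Integrable g μ)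
    (h0 : ∀ ω, 0 ≤ g ω) : ∫ ω, Real.sqrt (g ω) ∂μ ≤ Real.sqrt (∫ ω, g ω ∂μ) := by
  refine Real.le_sqrt_of_sq_le ?_
  have hs := integrable_sqrt hg h0
  set c := ∫ ω, Real.sqrt (g ω) ∂μ with hc
  have h : ∫ ω, (2 * c * Real.sqrt (g ω) - c ^ 2) ∂μ ≤ ∫ ω, g ω ∂μ :=
    integral_mono ((hs.const_mul _).sub (integrable_const _)) hg fun ω => by
      dsimp only
      nlinarith [sq_nonneg (Real.sqrt (g ω) - c), Real.sq_sqrt (h0 ω)]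
  rw [integral_sub (hs.const_mul _) (integrable_const _), integral_const_mul, ← hc] at h
  simp only [integral_const, probReal_univ, one_smul] at h
  linarith

theorem integral_mean_mul_mean {n : ℕ} {ε : Fin n → Ω → Fin T → ℝ}
    {Sigm : Fin n → Matrix (Fin T) (Fin T) ℝ}
    (hint : ∀ i i' t t', Integrable (fun ω => ε i ω t * ε i' ω t') μ)
    (hcov : ∀ i t t', ∫ ω, ε i ω t * ε i ω t' ∂μ = Sigm i t t')
    (huncorr : ∀ i i', i ≠ i' → ∀ t t', ∫ ω, ε i ω t * ε i' ω t' ∂μ = 0) (t t' : Fin T) :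
    Integrable (fun ω => ((n : ℝ)⁻¹ * ∑ i, ε i ω t) * ((n : ℝ)⁻¹ * ∑ i, ε i ω t')) μ ∧
      ∫ ω, ((n : ℝ)⁻¹ * ∑ i, ε i ω t) * ((n : ℝ)⁻¹ * ∑ i, ε i ω t') ∂μ =
        ((n : ℝ)⁻¹ • ((n : ℝ)⁻¹ • ∑ i, Sigm i)) t t' := by
  have hexp : ∀ ω, ((n : ℝ)⁻¹ * ∑ i, ε i ω t) * ((n : ℝ)⁻¹ * ∑ i, ε i ω t') =
      (n : ℝ)⁻¹ * ((n : ℝ)⁻¹ * ∑ i, ∑ i', ε i ω t * ε i' ω t') := fun ω => by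
    rw [← Finset.sum_mul_sum]
    ring
  have hI : ∀ i, Integrable (fun ω => ∑ i', ε i ω t * ε i' ω t') μ := fun i =>
    integrable_finsetSum _ fun i' _ => hint i i' t t'
  simp only [hexp]
  refine ⟨((integrable_finsetSum _ fun i _ => hI i).const_mul _).const_mul _, ?_⟩
  rw [integral_const_mul, integral_const_mul, integral_finsetSum _ fun i _ => hI i]
  simp only [Matrix.smul_apply, Matrix.sum_apply, smul_eq_mul]
  congr 2
  refine Finset.sum_congr rfl fun i _ => ?_
  rw [integral_finsetSum _ fun i' _ => hint i i' t t',
    Finset.sum_eq_single i (fun i' _ h => huncorr i i' h.symm t t') (by simp), hcov]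

end SecondMoments

theorem sqrt_add_dotProduct_self_le {m : Type*} [Fintype m] (x y : m → ℝ) :
    Real.sqrt ((x + y) ⬝ᵥ (x + y)) ≤ Real.sqrt (x ⬝ᵥ x) + Real.sqrt (y ⬝ᵥ y) := by
  have h := norm_add_le (WithLp.toLp 2 x : EuclideanSpace ℝ m) (WithLp.toLp 2 y)
  simpa [EuclideanSpace.norm_eq, dotProduct, sq] using h

theorem sieve_sobolev_bound
    {Ω : Type*} [MeasurableSpace Ω] (μ : Measure Ω) [IsProbabilityMeasure μ]
    {d : ℕ} (s : ℕ) (X : Set (Fin d → ℝ)) (hX : IsCompact X)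
    (f : (Fin d → ℝ) → ℝ) (hf : ContDiff ℝ (s : ℕ∞) f)
    (T P n : ℕ) (hT : 0 < T) (hP : 0 < P) (hn : 0 < n)
    (ψ : Fin P → (Fin d → ℝ) → ℝ) (hψ : ∀ j, ContDiff ℝ (s : ℕ∞) (ψ j))
    (Xpts : Fin T → (Fin d → ℝ)) (hXpts : ∀ t, Xpts t ∈ X)
    (Ψ : Matrix (Fin T) (Fin P) ℝ) (hΨdef : ∀ t j, Ψ t j = ψ j (Xpts t))
    (hΨ : IsUnit (Ψᵀ * Ψ).det)
    (hm : 0 < eigMin ((T : ℝ)⁻¹ • (Ψᵀ * Ψ)))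
    (β₀ : Fin P → ℝ)
    (ε : Fin n → Ω → Fin T → ℝ) (Sigm : Fin n → Matrix (Fin T) (Fin T) ℝ)
    (hmeas : ∀ i, Measurable (ε i))
    (hint : ∀ i i' t t', Integrable (fun ω => ε i ω t * ε i' ω t') μ)
    (hmean : ∀ i t, ∫ ω, ε i ω t ∂μ = 0)
    (hcov : ∀ i t t', ∫ ω, ε i ω t * ε i ω t' ∂μ = Sigm i t t')
    (huncorr : ∀ i i', i ≠ i' → ∀ t t', ∫ ω, ε i ω t * ε i' ω t' ∂μ = 0)
    (βhat : Ω → Fin P → ℝ)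
    (hβhat : ∀ ω, βhat ω =
      (Ψᵀ * Ψ)⁻¹.mulVec (Ψᵀ.mulVec (fun t => f (Xpts t) + (n : ℝ)⁻¹ * ∑ i, ε i ω t))) :
    ∫ ω, sobNorm s X (fun x => (∑ j, ψ j x * βhat ω j) - f x) ∂μ ≤
      zetaS s X ψ *
        (Real.sqrt
            (min ((P : ℝ) * eigMax ((n : ℝ)⁻¹ • ∑ i, Sigm i))
                (Matrix.trace ((n : ℝ)⁻¹ • ∑ i, Sigm i)) /
              ((n : ℝ) * (T : ℝ) * eigMin ((T : ℝ)⁻¹ • (Ψᵀ * Ψ)))) +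
          sobNorm s X (fun x => f x - ∑ j, ψ j x * β₀ j) /
            Real.sqrt (eigMin ((T : ℝ)⁻¹ • (Ψᵀ * Ψ)))) +
      sobNorm s X (fun x => f x - ∑ j, ψ j x * β₀ j) := by
  set m := eigMin ((T : ℝ)⁻¹ • (Ψᵀ * Ψ))
  set S := (n : ℝ)⁻¹ • ∑ i, Sigm i
  set N := sobNorm s X (fun x => f x - ∑ j, ψ j x * β₀ j)
  have hT' : (0 : ℝ) < T := by exact_mod_cast hT
  have hn' : (0 : ℝ) < n := by exact_mod_cast hn
  let Z : Ω → Fin T → ℝ := fun ω t => (n : ℝ)⁻¹ * ∑ i, ε i ω t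
  let r : Fin T → ℝ := fun t => f (Xpts t) - ∑ j, ψ j (Xpts t) * β₀ j
  have hZ : ∀ t t', Integrable (fun ω => Z ω t * Z ω t') μ := fun t t' =>
    (integral_mean_mul_mean hint hcov huncorr t t').1
  have hS : ∀ t t', ∫ ω, Z ω t * Z ω t' ∂μ = ((n : ℝ)⁻¹ • S) t t' := fun t t' =>
    (integral_mean_mul_mean hint hcov huncorr t t').2
  have hr : ∀ t, |r t| ≤ N := fun t =>
    abs_le_sobNorm hX (hf.sub (ContDiff.sum fun j _ => (hψ j).mul contDiff_const)) (hXpts t)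
  have hβ : ∀ ω, βhat ω - β₀ = lsCoeff Ψ (Z ω) + lsCoeff Ψ r := fun ω => by
    have hY : (fun t => f (Xpts t) + (n : ℝ)⁻¹ * ∑ i, ε i ω t) = Z ω + r + Ψ.mulVec β₀ := by
      funext t
      simp only [Z, r, Pi.add_apply, mulVec, dotProduct, hΨdef]
      ring
    rw [hβhat, hY, ← lsCoeff, lsCoeff_add, lsCoeff_add, lsCoeff_mulVec hΨ, add_sub_cancel_right]
  have hpt : ∀ ω, sobNorm s X (fun x => (∑ j, ψ j x * βhat ω j) - f x) ≤
      zetaS s X ψ * (Real.sqrt (lsCoeff Ψ (Z ω) ⬝ᵥ lsCoeff Ψ (Z ω)) + N / Real.sqrt m) + N :=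
    fun ω => by
      refine (sobNorm_sub_le hX hf hψ (βhat ω) β₀).trans ?_
      gcongr
      · exact zetaS_nonneg ψ
      · calc Real.sqrt (∑ j, (βhat ω j - β₀ j) ^ 2)
            = Real.sqrt ((βhat ω - β₀) ⬝ᵥ (βhat ω - β₀)) := by simp [dotProduct, sq]
          _ ≤ _ := by
            rw [hβ]
            exact (sqrt_add_dotProduct_self_le _ _).trans
              (add_le_add le_rfl (sqrt_lsCoeff_le hT hΨ hm (sobNorm_nonneg _) hr))
  have hbb : Integrable (fun ω => lsCoeff Ψ (Z ω) ⬝ᵥ lsCoeff Ψ (Z ω)) μ := by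
    simpa only [lsCoeff, mulVec_mulVec] using
      integrable_mulVec_dotProduct_self hZ ((Ψᵀ * Ψ)⁻¹ * Ψᵀ)
  have hfit : Integrable
      (fun ω => Ψ.mulVec (lsCoeff Ψ (Z ω)) ⬝ᵥ Ψ.mulVec (lsCoeff Ψ (Z ω))) μ := by
    simpa only [hatMatrix_mulVec] using integrable_mulVec_dotProduct_self hZ (hatMatrix Ψ)
  have hsqrt := integrable_sqrt hbb fun ω => zero_le_dotProduct_self _
  have hmean_sq : ∫ ω, lsCoeff Ψ (Z ω) ⬝ᵥ lsCoeff Ψ (Z ω) ∂μ ≤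
      min ((P : ℝ) * eigMax S) S.trace / (n * T * m) := by
    have h := (integral_mono (hbb.const_mul (T * m)) hfit fun ω =>
      eigMin_mul_dotProduct_self_le hT (lsCoeff Ψ (Z ω))).trans
      (integral_fitted_le hΨ (by positivity) hZ hS)
    rw [integral_const_mul, inv_mul_eq_div, le_div_iff₀ hn'] at h
    rw [le_div_iff₀ (by positivity)]
    linarith
  have hnoise := (integral_sqrt_le hbb fun ω => zero_le_dotProduct_self _).trans
    (Real.sqrt_le_sqrt hmean_sq)
  have hsum : Integrable (fun ω =>
      Real.sqrt (lsCoeff Ψ (Z ω) ⬝ᵥ lsCoeff Ψ (Z ω)) + N / Real.sqrt m) μ :=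
    hsqrt.add (integrable_const _)
  refine (integral_mono_of_nonneg (ae_of_all _ fun ω => sobNorm_nonneg _)
    ((hsum.const_mul _).add (integrable_const _))
    (ae_of_all _ hpt)).trans ?_
  simp only [Pi.add_apply]
  rw [integral_add (hsum.const_mul _) (integrable_const _), integral_const_mul,
    integral_add hsqrt (integrable_const _)]
  simp only [integral_const, probReal_univ, one_smul]
  gcongr
  exact zetaS_nonneg ψ
end

section
/- Let Ψ be a real T×P matrix with Ψ'Ψ invertible, Ψ̃ a real R×P matrix with Ψ̃Ψ̃' positive definite, Σ̄ a T×T symmetric positive definite matrix, n a positive integer, V := (1/n)·Ψ̃(Ψ'Ψ)⁻¹Ψ'Σ̄Ψ(Ψ'Ψ)⁻¹Ψ̃' (positive definite), and A := V^{-1/2} its symmetric positive definite inverse square root. Then for every unit vector v ∈ ℝ^R, (1/n)·v'AΨ̃(Ψ'Ψ)⁻¹Ψ̃'A'v ≤ 1/λ_min(Σ̄). -/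
open Matrix
open scoped BigOperators

/-- The infimum in `eigMin` is attained on the unit sphere. -/
theorem exists_eigMin_eq {m : Type*} [Fintype m] [Nonempty m] (M : Matrix m m ℝ) :
    ∃ x : m → ℝ, x ⬝ᵥ x = 1 ∧ eigMin M = x ⬝ᵥ M.mulVec x := by
  classical
  have hclosed : IsClosed {x : m → ℝ | x ⬝ᵥ x = 1} :=
    isClosed_eq (by unfold dotProduct; fun_prop) continuous_const
  have hsub : {x : m → ℝ | x ⬝ᵥ x = 1} ⊆ Set.Icc (-1) 1 := by
    intro x (hx : x ⬝ᵥ x = 1)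
    have h (i : m) : |x i| ≤ 1 := by
      rw [← sq_le_one_iff_abs_le_one, sq, ← hx]
      exact Finset.single_le_sum (f := fun j => x j * x j)
        (fun j _ => mul_self_nonneg (x j)) (Finset.mem_univ i)
    exact ⟨fun i => (abs_le.1 (h i)).1, fun i => (abs_le.1 (h i)).2⟩
  have hcompact : IsCompact {x : m → ℝ | x ⬝ᵥ x = 1} := isCompact_Icc.of_isClosed_subset hclosed hsub
  have hne : {x : m → ℝ | x ⬝ᵥ x = 1}.Nonempty :=
    ⟨Pi.single (Classical.arbitrary m) 1, by simp⟩
  have hcont : Continuous fun x : m → ℝ => x ⬝ᵥ M.mulVec x := by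
    unfold mulVec dotProduct; fun_prop
  obtain ⟨x, hx, h⟩ := hcompact.exists_sInf_image_eq hne hcont.continuousOn
  refine ⟨x, hx, ?_⟩
  rw [← h, eigMin]
  congr 1
  ext r
  simp [eq_comm]

theorem Matrix.PosDef.eigMin_pos {m : Type*} [Fintype m] [Nonempty m] {M : Matrix m m ℝ}
    (hM : M.PosDef) : 0 < eigMin M := by
  obtain ⟨x, hx, h⟩ := exists_eigMin_eq M
  rw [h]
  have hx0 : x ≠ 0 := by
    rintro rfl
    simp at hx
  simpa using hM.dotProduct_mulVec_pos hx0

theorem Matrix.PosSemidef.eigMin_mul_dotProduct_self_le {m : Type*} [Fintype m]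
    {M : Matrix m m ℝ} (hM : M.PosSemidef) (x : m → ℝ) :
    eigMin M * (x ⬝ᵥ x) ≤ x ⬝ᵥ M.mulVec x := by
  rcases eq_or_ne x 0 with rfl | hx
  · simp
  have hnorm : 0 < x ⬝ᵥ x := by simpa using dotProduct_star_self_pos_iff.2 hx
  have hsqrt : √(x ⬝ᵥ x) ≠ 0 := (Real.sqrt_pos.2 hnorm).ne'
  have hss : √(x ⬝ᵥ x) * √(x ⬝ᵥ x) = x ⬝ᵥ x := Real.mul_self_sqrt hnorm.le
  rw [← le_div_iff₀ hnorm]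
  refine csInf_le ⟨0, ?_⟩ ⟨(√(x ⬝ᵥ x))⁻¹ • x, ?_, ?_⟩
  · rintro r ⟨y, -, rfl⟩
    simpa using hM.dotProduct_mulVec_nonneg y
  · rw [smul_dotProduct, dotProduct_smul, smul_eq_mul, smul_eq_mul, ← mul_assoc, ← mul_inv, hss,
      inv_mul_cancel₀ hnorm.ne']
  · rw [mulVec_smul, smul_dotProduct, dotProduct_smul, smul_eq_mul, smul_eq_mul, ← mul_assoc,
      ← mul_inv, hss, div_eq_inv_mul]

theorem intermediate_inequality
    (T P R n : ℕ) (hT : 0 < T) (hP : 0 < P) (hR : 0 < R) (hn : 0 < n)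
    (Ψ : Matrix (Fin T) (Fin P) ℝ) (hΨ : IsUnit (Ψᵀ * Ψ).det)
    (Ψt : Matrix (Fin R) (Fin P) ℝ) (hΨt : (Ψt * Ψtᵀ).PosDef)
    (Sb : Matrix (Fin T) (Fin T) ℝ) (hSb : Sb.PosDef)
    (V : Matrix (Fin R) (Fin R) ℝ)
    (hV : V = (n : ℝ)⁻¹ • (Ψt * (Ψᵀ * Ψ)⁻¹ * Ψᵀ * Sb * Ψ * (Ψᵀ * Ψ)⁻¹ * Ψtᵀ))
    (hVpd : V.PosDef)
    -- `A = V^{-1/2}`: the symmetric positive definite square root of `V⁻¹`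
    (A : Matrix (Fin R) (Fin R) ℝ) (hA : A.PosDef) (hAV : V * (A * A) = 1) :
    ∀ v : Fin R → ℝ, v ⬝ᵥ v = 1 →
      (n : ℝ)⁻¹ * (v ⬝ᵥ (A * Ψt * (Ψᵀ * Ψ)⁻¹ * Ψtᵀ * Aᵀ).mulVec v) ≤
        1 / eigMin Sb := by
  intro v hv
  have : Nonempty (Fin T) := ⟨⟨0, hT⟩⟩
  have hn' : (0 : ℝ) < n := Nat.cast_pos.2 hn
  have hAt : Aᵀ = A := by simpa using hA.isHermitian.eq
  have hGt : ((Ψᵀ * Ψ)⁻¹)ᵀ = (Ψᵀ * Ψ)⁻¹ := by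
    rw [transpose_nonsing_inv, transpose_mul, transpose_transpose]
  set W := Ψ * (Ψᵀ * Ψ)⁻¹ * Ψtᵀ * A with hW
  have hWt : Wᵀ = A * Ψt * (Ψᵀ * Ψ)⁻¹ * Ψᵀ := by
    simp only [hW, transpose_mul, transpose_transpose, hAt, hGt, Matrix.mul_assoc]
  have hWW : A * Ψt * (Ψᵀ * Ψ)⁻¹ * Ψtᵀ * Aᵀ = Wᵀ * W := by
    have h : (Ψᵀ * Ψ)⁻¹ * (Ψᵀ * Ψ) = 1 := nonsing_inv_mul _ hΨ
    calc
      A * Ψt * (Ψᵀ * Ψ)⁻¹ * Ψtᵀ * Aᵀ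
        = A * Ψt * ((Ψᵀ * Ψ)⁻¹ * (Ψᵀ * Ψ)) * (Ψᵀ * Ψ)⁻¹ * Ψtᵀ * A := by
          rw [h, Matrix.mul_one, hAt]
      _ = Wᵀ * W := by rw [hWt, hW]; simp only [Matrix.mul_assoc]
  have hAVA : A * V * A = 1 := by
    rw [mul_eq_one_comm, ← Matrix.mul_assoc, mul_eq_one_comm]
    exact hAV
  have hWSW : Wᵀ * Sb * W = (n : ℝ) • 1 := by
    rw [← hAVA, hV, hWt, hW]
    simp only [Matrix.mul_smul, Matrix.smul_mul, smul_smul, mul_inv_cancel₀ hn'.ne', one_smul,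
      Matrix.mul_assoc]
  have hquad (M : Matrix (Fin T) (Fin T) ℝ) :
      W.mulVec v ⬝ᵥ M.mulVec (W.mulVec v) = v ⬝ᵥ (Wᵀ * M * W).mulVec v := by
    rw [← mulVec_mulVec v (Wᵀ * M) W, ← mulVec_mulVec _ Wᵀ M, dotProduct_mulVec v, vecMul_transpose]
  have hbound := hSb.posSemidef.eigMin_mul_dotProduct_self_le (W.mulVec v)
  have hself : W.mulVec v ⬝ᵥ W.mulVec v = v ⬝ᵥ (Wᵀ * W).mulVec v := by
    simpa using hquad 1
  rw [hquad, hWSW, hself, smul_mulVec, one_mulVec, dotProduct_smul, hv, smul_eq_mul,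
    mul_one] at hbound
  rw [hWW, le_div_iff₀ hSb.eigMin_pos, inv_mul_eq_div, div_mul_eq_mul_div, div_le_one hn',
    mul_comm]
  exact hbound
end
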